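/- Let ξ_1, ξ_2 be i.i.d. random variables with the exponential density e^{-x}·1_{x ≥ 0} and let Y = (ξ_1² + ξ_2²)/(ξ_1 + ξ_2)². Then Y takes values in [1/2, 1], and for every t ∈ [1/2, 1], P(Y ≤ t) = √(2t − 1). In particular Y has density f(t) = 1/√(2t−1) on [1/2, 1]. -/

import Mathlib

open MeasureTheory ProbabilityTheory Finset Real

-- the joint law of `m` i.i.d. standard exponential random variables.
noncomputable def expPi (m : ℕ) : Measure (Fin m → ℝ) :=
  Measure.pi fun _ => expMeasure 1

lemma expMeasure_one_eq : expMeasure 1 =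
    (volume.restrict (Set.Ioi (0:ℝ))).withDensity (fun x => ENNReal.ofReal (rexp (-x))) := by
  have h1 : expMeasure 1 = volume.withDensity (exponentialPDF 1) := rfl
  rw [h1, ← withDensity_indicator measurableSet_Ioi]
  apply withDensity_congr_ae
  have h0 : ∀ᵐ x : ℝ, x ≠ 0 := by simp [ae_iff]
  filter_upwards [h0] with x hx
  rcases lt_or_gt_of_ne hx with h | h
  · rw [exponentialPDF_of_neg h, Set.indicator_of_notMem]
    simpa using h.le
  · rw [exponentialPDF_of_nonneg h.le, Set.indicator_of_mem (by simpa using h)]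
    simp

lemma expMeasure_ae_pos : ∀ᵐ x ∂(expMeasure 1), 0 < x := by
  rw [expMeasure_one_eq]
  apply (withDensity_absolutelyContinuous _ _).ae_le
  exact ae_restrict_mem measurableSet_Ioi

lemma expMeasure_Icc {a b : ℝ} (ha : 0 < a) (hab : a ≤ b) :
    expMeasure 1 (Set.Icc a b) = ENNReal.ofReal (rexp (-a) - rexp (-b)) := by
  rw [expMeasure_one_eq, withDensity_apply _ measurableSet_Icc,
    Measure.restrict_restrict measurableSet_Icc,
    Set.inter_eq_left.2 (show Set.Icc a b ⊆ Set.Ioi 0 from fun x hx => lt_of_lt_of_le ha hx.1)]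
  rw [← ofReal_integral_eq_lintegral_ofReal]
  · rw [integral_Icc_eq_integral_Ioc, ← intervalIntegral.integral_of_le hab,
      intervalIntegral.integral_eq_sub_of_hasDerivAt (f := fun x => - rexp (-x))]
    · congr 1; ring
    · intro x _
      have := ((hasDerivAt_neg x).exp).neg
      rw [mul_neg_one, neg_neg] at this
      exact this
    · exact (by fun_prop : Continuous fun x : ℝ => rexp (-x)).intervalIntegrable _ _
  · exact (by fun_prop : Continuous fun x : ℝ => rexp (-x)).integrableOn_Icc
  · exact Filter.Eventually.of_forall fun x => (exp_pos _).le

instance : IsProbabilityMeasure (expMeasure 1) := isProbabilityMeasure_expMeasure one_pos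

lemma wedge_meas (c d : ℝ) :
    MeasurableSet {p : ℝ × ℝ | c * p.1 ≤ p.2 ∧ p.2 ≤ d * p.1} := by
  have h1 : MeasurableSet {p : ℝ × ℝ | c * p.1 ≤ p.2} :=
    measurableSet_le (by fun_prop) (by fun_prop)
  have h2 : MeasurableSet {p : ℝ × ℝ | p.2 ≤ d * p.1} :=
    measurableSet_le (by fun_prop) (by fun_prop)
  exact h1.inter h2

lemma exp_prod_wedge {c d : ℝ} (hc : 0 < c) (hcd : c ≤ d) :
    ((expMeasure 1).prod (expMeasure 1)) {p : ℝ × ℝ | c * p.1 ≤ p.2 ∧ p.2 ≤ d * p.1} =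
      ENNReal.ofReal (1 / (1 + c) - 1 / (1 + d)) := by
  have hm : MeasurableSet {p : ℝ × ℝ | c * p.1 ≤ p.2 ∧ p.2 ≤ d * p.1} :=
    wedge_meas _ _
  rw [Measure.prod_apply hm]
  have h1 : ∫⁻ x, expMeasure 1 (Prod.mk x ⁻¹' {p : ℝ × ℝ | c * p.1 ≤ p.2 ∧ p.2 ≤ d * p.1})
      ∂(expMeasure 1) = ∫⁻ x, ENNReal.ofReal (rexp (-(c * x)) - rexp (-(d * x)))
      ∂(expMeasure 1) := by
    apply lintegral_congr_ae
    filter_upwards [expMeasure_ae_pos] with x hx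
    exact expMeasure_Icc (a := c * x) (b := d * x) (by positivity) (by gcongr)
  rw [h1, expMeasure_one_eq, lintegral_withDensity_eq_lintegral_mul _ (by fun_prop) (by fun_prop)]
  have h2 : ∀ x : ℝ, ((fun x => ENNReal.ofReal (rexp (-x))) *
      (fun x => ENNReal.ofReal (rexp (-(c * x)) - rexp (-(d * x))))) x =
      ENNReal.ofReal (rexp (-(1 + c) * x) - rexp (-(1 + d) * x)) := by
    intro x
    simp only [Pi.mul_apply]
    rw [← ENNReal.ofReal_mul (exp_pos _).le, mul_sub, ← exp_add, ← exp_add]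
    congr 3 <;> ring_nf
  have hc1 := exp_neg_integrableOn_Ioi 0 (show 0 < 1 + c by linarith)
  have hd1 := exp_neg_integrableOn_Ioi 0 (show 0 < 1 + d by linarith)
  rw [lintegral_congr h2, ← ofReal_integral_eq_lintegral_ofReal
    (f := fun x => rexp (-(1 + c) * x) - rexp (-(1 + d) * x)) (hc1.sub hd1)]
  · rw [integral_sub hc1 hd1, integral_exp_mul_Ioi (by linarith), integral_exp_mul_Ioi (by linarith)]
    simp only [mul_zero, exp_zero, neg_div_neg_eq]
  · filter_upwards [ae_restrict_mem measurableSet_Ioi] with x hx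
    have hx' : 0 < x := hx
    simp only [Pi.zero_apply, sub_nonneg]
    apply exp_le_exp.2
    nlinarith

lemma lintegral_inv_sqrt {t : ℝ} (ht : 1 / 2 ≤ t) :
    ∫⁻ u in Set.Icc (1 / 2 : ℝ) t, ENNReal.ofReal (1 / √(2 * u - 1)) =
      ENNReal.ofReal √(2 * t - 1) := by
  have hcont : ContinuousOn (fun u : ℝ => √(2 * u - 1)) (Set.Icc (1 / 2) t) := by fun_prop
  have hder : ∀ x ∈ Set.Ioo (1 / 2 : ℝ) t,
      HasDerivAt (fun u : ℝ => √(2 * u - 1)) (1 / √(2 * x - 1)) x := by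
    intro x hx
    have h0 : 2 * x - 1 ≠ 0 := by have := hx.1; linarith
    have h := (((hasDerivAt_id x).const_mul 2).sub_const 1).sqrt h0
    convert h using 1
    simp only [id]
    rw [mul_one, div_mul_eq_div_div, div_self two_ne_zero]
    rfl
  have hint := intervalIntegral.integrableOn_deriv_of_nonneg hcont hder
    (fun x _ => by positivity)
  rw [setLIntegral_congr Ioc_ae_eq_Icc.symm, ← ofReal_integral_eq_lintegral_ofReal hint
    (Filter.Eventually.of_forall fun x => by simp only [Pi.zero_apply]; positivity),
    ← intervalIntegral.integral_of_le ht,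
    intervalIntegral.integral_eq_sub_of_hasDerivAt_of_le ht hcont hder
      ((intervalIntegrable_iff_integrableOn_Ioc_of_le ht).2 hint)]
  norm_num

lemma expPi_ae_pos : ∀ᵐ x ∂(expPi 2), 0 < x 0 ∧ 0 < x 1 := by
  have h : ∀ i : Fin 2, ∀ᵐ x ∂(expPi 2), 0 < x i := fun i =>
    (Measure.tendsto_eval_ae_ae (μ := fun _ : Fin 2 => expMeasure 1) (i := i)).eventually
      expMeasure_ae_pos
  filter_upwards [h 0, h 1] with x h0 h1 using ⟨h0, h1⟩

instance : IsProbabilityMeasure (expPi 2) := by unfold expPi; infer_instance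

lemma ratio_ae_mem :
    ∀ᵐ x ∂(expPi 2), (∑ i, (x i) ^ 2) / (∑ i, x i) ^ 2 ∈ Set.Icc (1 / 2 : ℝ) 1 := by
  filter_upwards [expPi_ae_pos] with x ⟨h0, h1⟩
  simp only [Fin.sum_univ_two]
  constructor
  · rw [le_div_iff₀ (by positivity)]
    nlinarith [sq_nonneg (x 0 - x 1)]
  · rw [div_le_one (by positivity)]
    nlinarith [mul_pos h0 h1]

lemma ratio_iff {x y s : ℝ} (hx : 0 < x) (hy : 0 < y) (hs : 0 ≤ s) (hs1 : s < 1) :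
    (x ^ 2 + y ^ 2) / (x + y) ^ 2 ≤ (1 + s ^ 2) / 2 ↔
      (1 - s) / (1 + s) * x ≤ y ∧ y ≤ (1 + s) / (1 - s) * x := by
  have h1 : 0 < 1 - s := by linarith
  have h2 : 0 < 1 + s := by linarith
  have e1 : (1 - s) / (1 + s) * x ≤ y ↔ (x - y) ≤ s * (x + y) := by
    rw [div_mul_eq_mul_div, div_le_iff₀ h2]
    constructor <;> intro h <;> linarith
  have e2 : y ≤ (1 + s) / (1 - s) * x ↔ -(s * (x + y)) ≤ x - y := by
    rw [div_mul_eq_mul_div, le_div_iff₀ h1]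
    constructor <;> intro h <;> linarith
  rw [e1, e2, div_le_iff₀ (by positivity), and_comm, ← abs_le,
    ← sq_le_sq₀ (abs_nonneg (x - y)) (by positivity), sq_abs]
  constructor <;> intro h <;> nlinarith

lemma ratio_cdf : ∀ t ∈ Set.Icc (1 / 2 : ℝ) 1,
      (expPi 2) {x | (∑ i, (x i) ^ 2) / (∑ i, x i) ^ 2 ≤ t} =
        ENNReal.ofReal (Real.sqrt (2 * t - 1)) := by
  rintro t ⟨ht0, ht1⟩
  rcases eq_or_lt_of_le ht1 with rfl | ht1
  · have : (expPi 2) {x | (∑ i, (x i) ^ 2) / (∑ i, x i) ^ 2 ≤ (1 : ℝ)} = 1 := by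
      refine le_antisymm prob_le_one ?_
      rw [← measure_univ (μ := expPi 2)]
      apply measure_mono_ae
      filter_upwards [ratio_ae_mem] with x hx _
      exact hx.2
    rw [this]
    norm_num
  obtain ⟨s, hs⟩ : ∃ s, s = √(2 * t - 1) := ⟨_, rfl⟩
  have hs0 : 0 ≤ s := hs ▸ Real.sqrt_nonneg _
  have hs2 : s ^ 2 = 2 * t - 1 := by rw [hs, Real.sq_sqrt (by linarith)]
  have hs1 : s < 1 := by nlinarith
  have ht : t = (1 + s ^ 2) / 2 := by linarith
  rw [← hs]
  have h1 : 0 < 1 - s := by linarith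
  have h2 : 0 < 1 + s := by linarith
  have hw := exp_prod_wedge (c := (1 - s) / (1 + s)) (d := (1 + s) / (1 - s)) (by positivity)
    (by rw [div_le_div_iff₀ h2 h1]; nlinarith)
  have hm : MeasurableSet {p : ℝ × ℝ | (1 - s) / (1 + s) * p.1 ≤ p.2 ∧
      p.2 ≤ (1 + s) / (1 - s) * p.1} :=
    wedge_meas _ _
  rw [← (measurePreserving_finTwoArrow (expMeasure 1)).measure_preimage hm.nullMeasurableSet] at hw
  have hval : 1 / (1 + (1 - s) / (1 + s)) - 1 / (1 + (1 + s) / (1 - s)) = s := by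
    have a1 : 1 + (1 - s) / (1 + s) = 2 / (1 + s) := by field_simp; ring
    have a2 : 1 + (1 + s) / (1 - s) = 2 / (1 - s) := by field_simp; ring
    rw [a1, a2, one_div_div, one_div_div]; ring
  rw [hval] at hw
  rw [← hw]
  apply measure_congr
  filter_upwards [expPi_ae_pos] with x ⟨h0, h1⟩
  apply propext
  have := ratio_iff h0 h1 hs0 hs1
  rw [← ht] at this
  change (∑ i, (x i) ^ 2) / (∑ i, x i) ^ 2 ≤ t ↔ _
  simp only [Fin.sum_univ_two]
  exact this

/-- For i.i.d. standard exponentials `ξ₁, ξ₂` and `Y = (ξ₁²+ξ₂²)/(ξ₁+ξ₂)²`: `Y` takes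
values in `[1/2, 1]` (a.s.), `P(Y ≤ t) = √(2t-1)` for `t ∈ [1/2, 1]`, and `Y` has
density `f(t) = 1/√(2t-1)` on `[1/2, 1]`. -/
theorem exp_ratio_cdf_two :
    (∀ᵐ x ∂(expPi 2), (∑ i, (x i) ^ 2) / (∑ i, x i) ^ 2 ∈ Set.Icc (1 / 2 : ℝ) 1)
    ∧
    (∀ t ∈ Set.Icc (1 / 2 : ℝ) 1,
      (expPi 2) {x | (∑ i, (x i) ^ 2) / (∑ i, x i) ^ 2 ≤ t} =
        ENNReal.ofReal (Real.sqrt (2 * t - 1)))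
    ∧
    Measure.map (fun x : Fin 2 → ℝ => (∑ i, (x i) ^ 2) / (∑ i, x i) ^ 2) (expPi 2) =
      (volume.restrict (Set.Icc (1 / 2 : ℝ) 1)).withDensity
        (fun t => ENNReal.ofReal (1 / Real.sqrt (2 * t - 1))) := by
  refine ⟨ratio_ae_mem, ratio_cdf, ?_⟩
  have hmeas : Measurable (fun x : Fin 2 → ℝ => (∑ i, (x i) ^ 2) / (∑ i, x i) ^ 2) := by
    fun_prop
  have : IsProbabilityMeasure
      (Measure.map (fun x : Fin 2 → ℝ => (∑ i, (x i) ^ 2) / (∑ i, x i) ^ 2) (expPi 2)) :=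
    Measure.isProbabilityMeasure_map hmeas.aemeasurable
  apply Measure.ext_of_Iic
  intro t
  rw [Measure.map_apply hmeas measurableSet_Iic, withDensity_apply _ measurableSet_Iic,
    Measure.restrict_restrict measurableSet_Iic]
  rcases lt_or_ge t (1 / 2) with h | h
  · have e : Set.Iic t ∩ Set.Icc (1 / 2 : ℝ) 1 = ∅ := by
      ext u; simp only [Set.mem_inter_iff, Set.mem_Iic, Set.mem_Icc, Set.mem_empty_iff_false]
      constructor
      · rintro ⟨h1, h2, _⟩; linarith
      · simp
    rw [e, Measure.restrict_empty, lintegral_zero_measure]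
    have hz := ae_iff.1 ratio_ae_mem
    refine measure_mono_null ?_ hz
    intro x hx hx'
    have h3 : (∑ i, (x i) ^ 2) / (∑ i, x i) ^ 2 ≤ t := hx
    have := hx'.1
    linarith
  · have hm : min t 1 ∈ Set.Icc (1 / 2 : ℝ) 1 :=
      ⟨le_min h (by norm_num), min_le_right _ _⟩
    have e : Set.Iic t ∩ Set.Icc (1 / 2 : ℝ) 1 = Set.Icc (1 / 2) (min t 1) := by
      ext u; simp only [Set.mem_inter_iff, Set.mem_Iic, Set.mem_Icc, le_min_iff]; tauto
    rw [e, lintegral_inv_sqrt hm.1]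
    refine Eq.trans ?_ (ratio_cdf (min t 1) hm)
    refine measure_congr ?_
    filter_upwards [ratio_ae_mem] with x hx
    apply propext
    change (∑ i, (x i) ^ 2) / (∑ i, x i) ^ 2 ≤ t ↔ (∑ i, (x i) ^ 2) / (∑ i, x i) ^ 2 ≤ min t 1
    rw [le_min_iff]
    exact ⟨fun h => ⟨h, hx.2⟩, fun h => h.1⟩
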